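/- The differential S-Heun operators L̄ = d/dx, M̄₁ = 1, M̄₂ = x d/dx, R̄₁ = multiplication by x, R̄₂ = x² d/dx satisfy, as linear operators on ℝ[x], the fourteen homogeneous quadratic reordering relations: M̄₁L̄ = L̄M̄₁; M̄₂L̄ = L̄M̄₂ − M̄₁L̄; M̄₂M̄₁ = M̄₁M̄₂; M̄₁² = 1; L̄R̄₁ = 1 + M̄₁M̄₂; L̄R̄₂ = M̄₂² + M̄₁M̄₂; R̄₁L̄ = M̄₁M̄₂; R̄₂L̄ = M̄₂² − M̄₁M̄₂; R̄₂R̄₁ = R̄₁R̄₂ + R̄₁²; R̄₁M̄₁ = M̄₂R̄₁ − M̄₁R̄₂; R̄₂M̄₁ = M̄₁R̄₂; R̄₁M̄₂ = M̄₁R̄₂; R̄₂M̄₂ = M̄₂R̄₂ − M̄₁R̄₂; M̄₁R̄₁ = M̄₂R̄₁ − M̄₁R̄₂. -/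

import Mathlib

open Polynomial

/-- Differential S-Heun operator `L̄ = d/dx` on `ℝ[x]`. -/
noncomputable def Lb (p : ℝ[X]) : ℝ[X] := derivative p
/-- Differential S-Heun operator `M̄₁ = 1` (identity). -/
def M1b (p : ℝ[X]) : ℝ[X] := p
/-- Differential S-Heun operator `M̄₂ = x d/dx`. -/
noncomputable def M2b (p : ℝ[X]) : ℝ[X] := X * derivative p
/-- Differential S-Heun operator `R̄₁ = x` (multiplication by the variable). -/
noncomputable def R1b (p : ℝ[X]) : ℝ[X] := X * p
/-- Differential S-Heun operator `R̄₂ = x² d/dx`. -/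
noncomputable def R2b (p : ℝ[X]) : ℝ[X] := X^2 * derivative p

/-- The fourteen homogeneous quadratic reordering relations between the differential
S-Heun operators on `ℝ[x]`. -/
theorem stmt_17 :
    (∀ p : ℝ[X], M1b (Lb p) = Lb (M1b p)) ∧
    (∀ p : ℝ[X], M2b (Lb p) = Lb (M2b p) - M1b (Lb p)) ∧
    (∀ p : ℝ[X], M2b (M1b p) = M1b (M2b p)) ∧
    (∀ p : ℝ[X], M1b (M1b p) = p) ∧
    (∀ p : ℝ[X], Lb (R1b p) = p + M1b (M2b p)) ∧
    (∀ p : ℝ[X], Lb (R2b p) = M2b (M2b p) + M1b (M2b p)) ∧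
    (∀ p : ℝ[X], R1b (Lb p) = M1b (M2b p)) ∧
    (∀ p : ℝ[X], R2b (Lb p) = M2b (M2b p) - M1b (M2b p)) ∧
    (∀ p : ℝ[X], R2b (R1b p) = R1b (R2b p) + R1b (R1b p)) ∧
    (∀ p : ℝ[X], R1b (M1b p) = M2b (R1b p) - M1b (R2b p)) ∧
    (∀ p : ℝ[X], R2b (M1b p) = M1b (R2b p)) ∧
    (∀ p : ℝ[X], R1b (M2b p) = M1b (R2b p)) ∧
    (∀ p : ℝ[X], R2b (M2b p) = M2b (R2b p) - M1b (R2b p)) ∧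
    (∀ p : ℝ[X], M1b (R1b p) = M2b (R1b p) - M1b (R2b p)) := by
  refine ⟨?_, ?_, ?_, ?_, ?_, ?_, ?_, ?_, ?_, ?_, ?_, ?_, ?_, ?_⟩ <;> intro p <;>
    simp only [Lb, M1b, M2b, R1b, R2b, derivative_mul, derivative_X, derivative_X_sq, map_ofNat] <;>
    ring
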